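/- Let N ≥ 2 and 1 < p < N. Suppose u ≥ 0 is classically p-superharmonic on {x : ‖x‖ > 1} ⊆ EuclideanSpace ℝ (Fin N). Then the function m(r) = inf { u(x) : r < ‖x‖ < 2r } is bounded above on [2,∞), i.e. there exists C > 0 with m(r) ≤ C for all r ≥ 2. -/

import Mathlib

open MeasureTheory Filter Real Matrix
open scoped RealInnerProductSpace

/-- The vector field `F_p u (x) = ‖∇u(x)‖^(p-2) • ∇u(x)` (real power; equal to `0`
when `∇u(x) = 0`). -/
noncomputable def pFlux (N : ℕ) (p : ℝ) (u : EuclideanSpace ℝ (Fin N) → ℝ)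
    (x : EuclideanSpace ℝ (Fin N)) : EuclideanSpace ℝ (Fin N) :=
  ‖gradient u x‖ ^ (p - 2) • gradient u x

/-- The `p`-Laplacian `Δ_p u (x) = div (F_p u) (x)`. -/
noncomputable def pLaplacian (N : ℕ) (p : ℝ) (u : EuclideanSpace ℝ (Fin N) → ℝ)
    (x : EuclideanSpace ℝ (Fin N)) : ℝ :=
  ∑ i : Fin N, ⟪fderiv ℝ (pFlux N p u) x (EuclideanSpace.basisFun (Fin N) ℝ i),
      EuclideanSpace.basisFun (Fin N) ℝ i⟫

/-- `u` is a classical supersolution of `-Δ_p u ≥ g` on `Ω`. -/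
def IsPSupersolution (N : ℕ) (p : ℝ) (u : EuclideanSpace ℝ (Fin N) → ℝ)
    (g : EuclideanSpace ℝ (Fin N) → ℝ) (Ω : Set (EuclideanSpace ℝ (Fin N))) : Prop :=
  ContDiffOn ℝ 1 u Ω ∧ DifferentiableOn ℝ (pFlux N p u) Ω ∧
    ∀ x ∈ Ω, -pLaplacian N p u x ≥ g x

/-- Derivative of a real power of the norm away from the origin. -/
lemma hasFDerivAt_norm_rpow_of_ne_zero {E : Type*} [NormedAddCommGroup E] [InnerProductSpace ℝ E]
    (s : ℝ) {y : E} (hy : y ≠ 0) :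
    HasFDerivAt (fun z : E => ‖z‖ ^ s) ((s * ‖y‖ ^ (s - 2)) • innerSL ℝ y) y := by
  have hpow : ∀ (t : ℝ) (z : E), (‖z‖ ^ 2) ^ (t / 2) = ‖z‖ ^ t := by
    intro t z
    rw [← Real.rpow_natCast, ← Real.rpow_mul (norm_nonneg z)]
    congr 1
    push_cast
    ring
  have h := (hasStrictFDerivAt_norm_sq y).hasFDerivAt.rpow_const (p := s / 2)
    (Or.inl (by positivity))
  simp only [hpow] at h
  have h1 : s / 2 - 1 = (s - 2) / 2 := by ring
  rw [h1, hpow] at h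
  refine h.congr_fderiv ?_
  ext v
  simp
  ring

/-- Derivative of `z ↦ ‖z‖ ^ s • z` away from the origin. -/
lemma hasFDerivAt_norm_rpow_smul_self {E : Type*} [NormedAddCommGroup E] [InnerProductSpace ℝ E]
    (s : ℝ) {y : E} (hy : y ≠ 0) :
    HasFDerivAt (fun z : E => ‖z‖ ^ s • z)
      (‖y‖ ^ s • ContinuousLinearMap.id ℝ E +
        ((s * ‖y‖ ^ (s - 2)) • innerSL ℝ y).smulRight y) y :=
  (hasFDerivAt_norm_rpow_of_ne_zero s hy).smul (hasFDerivAt_id y)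

/-- The maps `z ↦ ‖z‖ ^ (p - 2) • z` and `z ↦ ‖z‖ ^ (-(p - 2) / (p - 1)) • z` are inverse. -/
lemma norm_rpow_smul_norm_rpow_smul {E : Type*} [NormedAddCommGroup E] [NormedSpace ℝ E]
    {p : ℝ} (hp : 1 < p) (z : E) :
    ‖‖z‖ ^ (p - 2) • z‖ ^ (-(p - 2) / (p - 1)) • ‖z‖ ^ (p - 2) • z = z := by
  rcases eq_or_ne z 0 with rfl | hz
  · simp
  have hz' : 0 < ‖z‖ := norm_pos_iff.2 hz
  have hn : ‖‖z‖ ^ (p - 2) • z‖ = ‖z‖ ^ (p - 1) := by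
    rw [norm_smul, Real.norm_of_nonneg (by positivity)]
    nth_rewrite 2 [← Real.rpow_one ‖z‖]
    rw [← Real.rpow_add hz']
    congr 1
    ring
  have hp1 : p - 1 ≠ 0 := by linarith
  rw [hn, smul_smul, ← Real.rpow_mul hz'.le, ← Real.rpow_add hz', mul_div_cancel₀ _ hp1]
  simp

/-- The derivative of the gradient at a local minimum is positive semidefinite. -/
lemma IsLocalMin.inner_fderiv_gradient_nonneg {E : Type*} [NormedAddCommGroup E]
    [InnerProductSpace ℝ E] {w : E → ℝ} {g : E → E} {H : E →L[ℝ] E} {x : E}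
    (hmin : IsLocalMin w x) (hg : ∀ᶠ y in nhds x, HasFDerivAt w (innerSL ℝ (g y)) y)
    (hH : HasFDerivAt g H x) (v : E) : 0 ≤ ⟪H v, v⟫ := by
  have hline : ∀ t : ℝ, HasDerivAt (fun t : ℝ => x + t • v) v t := fun t => by
    simpa using ((hasDerivAt_id t).smul_const v).const_add x
  have htend : Tendsto (fun t : ℝ => x + t • v) (nhds 0) (nhds x) := by
    simpa using (hline 0).continuousAt.tendsto
  have hd : ∀ᶠ t : ℝ in nhds 0,
      HasDerivAt (fun t : ℝ => w (x + t • v)) ⟪g (x + t • v), v⟫ t := by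
    filter_upwards [htend.eventually hg] with t ht
    exact ht.comp_hasDerivAt t (hline t)
  have hderiv : deriv (fun t : ℝ => w (x + t • v)) =ᶠ[nhds 0] fun t => ⟪g (x + t • v), v⟫ :=
    hd.mono fun t ht => ht.deriv
  have hd2 : HasDerivAt (fun t : ℝ => ⟪g (x + t • v), v⟫) ⟪H v, v⟫ 0 := by
    have h1 : HasDerivAt (fun t : ℝ => g (x + t • v)) (H v) 0 :=
      HasFDerivAt.comp_hasDerivAt (0 : ℝ) (by simpa using hH) (hline 0)
    simpa using h1.inner ℝ (hasDerivAt_const (0 : ℝ) v)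
  have hdd : deriv (deriv fun t : ℝ => w (x + t • v)) 0 = ⟪H v, v⟫ := by
    rw [hderiv.deriv_eq, hd2.deriv]
  have hmin0 : IsLocalMin (fun t : ℝ => w (x + t • v)) 0 := by
    simpa [IsLocalMin, IsMinFilter] using htend.eventually hmin
  by_contra! hneg
  have hmax0 : IsLocalMax (fun t : ℝ => w (x + t • v)) 0 :=
    isLocalMax_of_deriv_deriv_neg (by rwa [hdd]) hmin0.deriv_eq_zero
      hd.self_of_nhds.continuousAt
  have hconst : (fun t : ℝ => w (x + t • v)) =ᶠ[nhds 0] fun _ => w (x + (0 : ℝ) • v) := by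
    filter_upwards [hmin0, hmax0] with t h1 h2 using le_antisymm h2 h1
  rw [hconst.deriv.deriv_eq] at hdd
  simp at hdd
  linarith

lemma EuclideanSpace.sum_inner_smul_basisFun {N : ℕ} (e : EuclideanSpace ℝ (Fin N)) :
    ∑ i, ⟪e, EuclideanSpace.basisFun (Fin N) ℝ i⟫ • EuclideanSpace.basisFun (Fin N) ℝ i = e := by
  simpa only [real_inner_comm] using (EuclideanSpace.basisFun (Fin N) ℝ).sum_repr' e

/-- The trace of the product of a positive semidefinite operator with
`I + (p - 2) ξ ⊗ ξ / ‖ξ‖ ^ 2` is nonnegative. -/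
lemma sum_inner_add_mul_inner_nonneg {N : ℕ} {p : ℝ} (hp : 1 < p)
    {H : EuclideanSpace ℝ (Fin N) →L[ℝ] EuclideanSpace ℝ (Fin N)} (hH : ∀ v, 0 ≤ ⟪H v, v⟫)
    {e : EuclideanSpace ℝ (Fin N)} (he : ‖e‖ = 1) :
    0 ≤ ∑ i, ⟪H (EuclideanSpace.basisFun (Fin N) ℝ i), EuclideanSpace.basisFun (Fin N) ℝ i⟫ +
      (p - 2) * ⟪H e, e⟫ := by
  set b := EuclideanSpace.basisFun (Fin N) ℝ
  set c : ℝ := √(p - 1) - 1 with hc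
  have hc2 : 2 * c + c ^ 2 = p - 2 := by
    have := Real.sq_sqrt (show 0 ≤ p - 1 by linarith)
    rw [hc]; linarith
  have key : ∑ i, ⟪H (b i + (c * ⟪e, b i⟫) • e), b i + (c * ⟪e, b i⟫) • e⟫ =
      ∑ i, ⟪H (b i), b i⟫ + (p - 2) * ⟪H e, e⟫ := by
    have h1 : ∑ i, ⟪e, b i⟫ * ⟪H e, b i⟫ = ⟪H e, e⟫ := by
      have : ⟪H e, ∑ i, ⟪e, b i⟫ • b i⟫ = ⟪H e, e⟫ := by
        rw [EuclideanSpace.sum_inner_smul_basisFun e]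
      rw [← this, inner_sum]
      simp only [real_inner_smul_right]
    have h2 : ∑ i, ⟪e, b i⟫ * ⟪H (b i), e⟫ = ⟪H e, e⟫ := by
      have : H e = ∑ i, ⟪e, b i⟫ • H (b i) := by
        conv_lhs => rw [← EuclideanSpace.sum_inner_smul_basisFun e]
        simp only [map_sum, map_smul, b]
      rw [this, sum_inner]
      simp [inner_smul_left]
    have h3 : ∑ i, ⟪e, b i⟫ * ⟪e, b i⟫ = 1 := by
      have := b.sum_sq_inner_left e
      simp only [he] at this
      simpa [sq, real_inner_comm] using this
    have h4 : ∀ i, ⟪H (b i + (c * ⟪e, b i⟫) • e), b i + (c * ⟪e, b i⟫) • e⟫ =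
        ⟪H (b i), b i⟫ + c * (⟪e, b i⟫ * ⟪H (b i), e⟫) + c * (⟪e, b i⟫ * ⟪H e, b i⟫) +
          (c ^ 2 * ⟪H e, e⟫) * (⟪e, b i⟫ * ⟪e, b i⟫) := by
      intro i
      simp only [map_add, map_smul, inner_add_left, inner_add_right, real_inner_smul_left,
        real_inner_smul_right]
      ring
    simp only [h4, Finset.sum_add_distrib, ← Finset.mul_sum, h1, h2, h3]
    rw [← hc2]; ring
  rw [← key]
  exact Finset.sum_nonneg fun i _ => hH _

/-- Nondivergence form of the `p`-Laplacian at a noncritical point. -/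
lemma pLaplacian_eq_of_hasFDerivAt_gradient {N : ℕ} (p : ℝ) {u : EuclideanSpace ℝ (Fin N) → ℝ}
    {x : EuclideanSpace ℝ (Fin N)} {H : EuclideanSpace ℝ (Fin N) →L[ℝ] EuclideanSpace ℝ (Fin N)}
    (hH : HasFDerivAt (gradient u) H x) {k : ℝ} (hk : 0 < k) {e : EuclideanSpace ℝ (Fin N)}
    (he : ‖e‖ = 1) (hgrad : gradient u x = k • e) :
    pLaplacian N p u x = k ^ (p - 2) *
      (∑ i, ⟪H (EuclideanSpace.basisFun (Fin N) ℝ i), EuclideanSpace.basisFun (Fin N) ℝ i⟫ +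
        (p - 2) * ⟪H e, e⟫) := by
  have hn : ‖gradient u x‖ = k := by rw [hgrad, norm_smul, he, Real.norm_of_nonneg hk.le, mul_one]
  have hne : gradient u x ≠ 0 := by rw [← norm_pos_iff, hn]; exact hk
  have hF : HasFDerivAt (pFlux N p u) _ x :=
    (hasFDerivAt_norm_rpow_smul_self (p - 2) hne).comp x hH
  have h2 : H e = ∑ i, ⟪e, EuclideanSpace.basisFun (Fin N) ℝ i⟫ •
      H (EuclideanSpace.basisFun (Fin N) ℝ i) := by
    conv_lhs => rw [← EuclideanSpace.sum_inner_smul_basisFun e]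
    simp only [map_sum, map_smul]
  rw [pLaplacian, hF.fderiv, hn, hgrad, h2, sum_inner, mul_add, Finset.mul_sum, Finset.mul_sum,
    Finset.mul_sum, ← Finset.sum_add_distrib]
  refine Finset.sum_congr rfl fun i _ => ?_
  have hkp : k ^ (p - 2) = k ^ (p - 2 - 2) * (k * k) := by
    rw [← sq, ← Real.rpow_natCast, ← Real.rpow_add hk]
    congr 1
    push_cast
    ring
  simp only [ContinuousLinearMap.comp_apply, _root_.add_apply,
    _root_.smul_apply, ContinuousLinearMap.id_apply,
    ContinuousLinearMap.smulRight_apply, innerSL_apply_apply, inner_add_left,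
    real_inner_smul_left, smul_eq_mul]
  rw [hkp, real_inner_comm e (H _)]
  ring

/-- If the flux is differentiable at a noncritical point, then so is the gradient. -/
lemma differentiableAt_gradient_of_pFlux {N : ℕ} {p : ℝ} (hp : 1 < p)
    {u : EuclideanSpace ℝ (Fin N) → ℝ} {x : EuclideanSpace ℝ (Fin N)}
    (hF : DifferentiableAt ℝ (pFlux N p u) x) (hne : gradient u x ≠ 0) :
    DifferentiableAt ℝ (gradient u) x := by
  have hne' : pFlux N p u x ≠ 0 := by
    have := norm_pos_iff.2 hne
    exact smul_ne_zero (by positivity) hne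
  have h := ((hasFDerivAt_norm_rpow_smul_self (-(p - 2) / (p - 1)) hne').comp x
    hF.hasFDerivAt).differentiableAt
  have heq : (fun z => ‖z‖ ^ (-(p - 2) / (p - 1)) • z) ∘ pFlux N p u = gradient u :=
    funext fun y => norm_rpow_smul_norm_rpow_smul hp (gradient u y)
  rwa [heq] at h

/-- A `p`-superharmonic function minus a strictly `p`-subharmonic radial barrier has no interior
local minimum. -/
lemma not_isLocalMin_sub_barrier {N : ℕ} {p : ℝ} (hp : 1 < p)
    {u : EuclideanSpace ℝ (Fin N) → ℝ} {x : EuclideanSpace ℝ (Fin N)} (hx : x ≠ 0)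
    (hu : ∀ᶠ y in nhds x, DifferentiableAt ℝ u y)
    (hF : DifferentiableAt ℝ (pFlux N p u) x) (hsuper : pLaplacian N p u x ≤ 0)
    {k α : ℝ} (hk : 0 < k) (hα : 0 < α) (hαp : α * (p - 1) < N - p) :
    ¬ IsLocalMin (fun y => u y + k * ‖y‖ ^ (-α)) x := by
  intro hmin
  have hx0 : 0 < ‖x‖ := norm_pos_iff.2 hx
  set g : EuclideanSpace ℝ (Fin N) → EuclideanSpace ℝ (Fin N) :=
    fun y => gradient u y - (k * α) • (‖y‖ ^ (-α - 2) • y) with hgdef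
  have hg : ∀ᶠ y in nhds x,
      HasFDerivAt (fun y => u y + k * ‖y‖ ^ (-α)) (innerSL ℝ (g y)) y := by
    filter_upwards [hu, isOpen_ne.mem_nhds hx] with y hy hy0
    refine (hy.hasFDerivAt.add
      ((hasFDerivAt_norm_rpow_of_ne_zero (-α) hy0).const_mul k)).congr_fderiv ?_
    ext v
    have h1 : fderiv ℝ u y v = ⟪gradient u y, v⟫ := by
      simp [gradient]
    simp only [hgdef, _root_.add_apply, _root_.smul_apply, innerSL_apply_apply, inner_sub_left,
      real_inner_smul_left, h1, smul_eq_mul]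
    ring
  have hgx : g x = 0 := by
    have h1 := hmin.hasFDerivAt_eq_zero hg.self_of_nhds
    have h2 := DFunLike.congr_fun h1 (g x)
    simpa using h2
  set κ : ℝ := k * α * ‖x‖ ^ (-α - 2) with hκ
  have hκ0 : 0 < κ := by positivity
  set e := ‖x‖⁻¹ • x with he
  have he1 : ‖e‖ = 1 := by
    rw [he, norm_smul, norm_inv, norm_norm, inv_mul_cancel₀ hx0.ne']
  have hxe : x = ‖x‖ • e := by rw [he, smul_smul, mul_inv_cancel₀ hx0.ne', one_smul]
  have hgrad : gradient u x = (κ * ‖x‖) • e := by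
    rw [← smul_smul, ← hxe, hκ, ← smul_smul]
    exact sub_eq_zero.1 hgx
  have hne : gradient u x ≠ 0 := by
    rw [hgrad]
    exact smul_ne_zero (by positivity) (by rw [← norm_pos_iff, he1]; exact one_pos)
  have hHu := (differentiableAt_gradient_of_pFlux hp hF hne).hasFDerivAt
  set Hu := fderiv ℝ (gradient u) x
  have hH := hHu.sub ((hasFDerivAt_norm_rpow_smul_self (-α - 2) hx).const_smul (k * α))
  have hpos := sum_inner_add_mul_inner_nonneg hp
    (fun v => hmin.inner_fderiv_gradient_nonneg hg hH v) he1
  rw [pLaplacian_eq_of_hasFDerivAt_gradient p hHu (by positivity) he1 hgrad] at hsuper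
  have hle := nonpos_of_mul_nonpos_right hsuper (by positivity)
  have hxx : ‖x‖ ^ (-α - 2) = ‖x‖ ^ (-α - 2 - 2) * (‖x‖ * ‖x‖) := by
    rw [← sq, ← Real.rpow_natCast, ← Real.rpow_add hx0]
    congr 1
    push_cast
    ring
  have hB : ∀ v, ⟪(Hu - (k * α) • (‖x‖ ^ (-α - 2) •
      ContinuousLinearMap.id ℝ (EuclideanSpace ℝ (Fin N)) + (((-α - 2) * ‖x‖ ^ (-α - 2 - 2)) • innerSL ℝ x).smulRight x)) v, v⟫ =
      ⟪Hu v, v⟫ - κ * (⟪v, v⟫ - (α + 2) * (⟪e, v⟫ * ⟪e, v⟫)) := by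
    intro v
    simp only [_root_.sub_apply, _root_.add_apply,
      _root_.smul_apply, ContinuousLinearMap.id_apply,
      ContinuousLinearMap.smulRight_apply, innerSL_apply_apply, inner_add_left, inner_sub_left,
      real_inner_smul_left, smul_eq_mul]
    have hxv : ⟪x, v⟫ = ‖x‖ * ⟪e, v⟫ := by
      conv_lhs => rw [hxe]
      rw [real_inner_smul_left]
    rw [hxv, hκ, hxx]
    ring
  simp only [hB] at hpos
  have hee : ⟪e, e⟫ = (1 : ℝ) := by rw [real_inner_self_eq_norm_sq, he1, one_pow]
  have h3 : ∑ i, ⟪e, EuclideanSpace.basisFun (Fin N) ℝ i⟫ *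
      ⟪e, EuclideanSpace.basisFun (Fin N) ℝ i⟫ = 1 := by
    have := (EuclideanSpace.basisFun (Fin N) ℝ).sum_sq_inner_left e
    simp only [he1] at this
    simpa [sq, real_inner_comm] using this
  have h4 : ∑ i, ⟪EuclideanSpace.basisFun (Fin N) ℝ i, EuclideanSpace.basisFun (Fin N) ℝ i⟫ =
      (N : ℝ) := by
    simp
  rw [Finset.sum_sub_distrib, ← Finset.mul_sum, Finset.sum_sub_distrib, ← Finset.mul_sum, h3, h4,
    hee] at hpos
  have : 0 < κ * (N - p - α * (p - 1)) := mul_pos hκ0 (by linarith)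
  linarith

/-- If `N ≥ 2`, `1 < p < N`, and `u ≥ 0` is classically `p`-superharmonic on `{‖x‖ > 1}`,
then `m(r) = inf_{r < ‖x‖ < 2r} u(x)` is bounded above on `[2,∞)`. -/
theorem m_bounded_p_lt_N (N : ℕ) (hN : 2 ≤ N) (p : ℝ) (hp : 1 < p) (hpN : p < (N : ℝ))
    (u : EuclideanSpace ℝ (Fin N) → ℝ)
    (hu_nonneg : ∀ x : EuclideanSpace ℝ (Fin N), 1 < ‖x‖ → 0 ≤ u x)
    (hu_super : IsPSupersolution N p u (fun _ => 0)
      {x : EuclideanSpace ℝ (Fin N) | 1 < ‖x‖}) :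
    ∃ C : ℝ, 0 < C ∧ ∀ r : ℝ, 2 ≤ r →
      sInf (u '' {x : EuclideanSpace ℝ (Fin N) | r < ‖x‖ ∧ ‖x‖ < 2 * r}) ≤ C := by
  set α : ℝ := (N - p) / (2 * (p - 1)) with hα
  have hp1 : 0 < p - 1 := by linarith
  have hα0 : 0 < α := div_pos (by linarith) (by linarith)
  have hαp : α * (p - 1) < N - p := by
    have : α * (p - 1) = (N - p) / 2 := by rw [hα]; field_simp
    linarith
  have hNpos : 0 < N := by omega
  set x₀ : EuclideanSpace ℝ (Fin N) := (2 : ℝ) • EuclideanSpace.basisFun (Fin N) ℝ ⟨0, hNpos⟩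
  have hx₀ : ‖x₀‖ = 2 := by simp [x₀, norm_smul]
  set δ : ℝ := 1 - (3 / 2 : ℝ) ^ α * 2 ^ (-α) with hδ
  have hδ0 : 0 < δ := by
    have h1 : (3 / 2 : ℝ) ^ α * 2 ^ (-α) < 2 ^ α * 2 ^ (-α) := by
      gcongr
      norm_num
    rw [← Real.rpow_add two_pos, add_neg_cancel, Real.rpow_zero] at h1
    linarith
  have hu₀ : 0 ≤ u x₀ := hu_nonneg x₀ (by rw [hx₀]; norm_num)
  refine ⟨u x₀ / δ + 1, by positivity, fun r hr => ?_⟩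
  set M := sInf (u '' {x : EuclideanSpace ℝ (Fin N) | r < ‖x‖ ∧ ‖x‖ < 2 * r})
  have hM : ∀ x : EuclideanSpace ℝ (Fin N), r < ‖x‖ → ‖x‖ < 2 * r → M ≤ u x := by
    intro x h1 h2
    refine csInf_le ⟨0, ?_⟩ ⟨x, ⟨h1, h2⟩, rfl⟩
    rintro _ ⟨y, ⟨hy, -⟩, rfl⟩
    exact hu_nonneg y (by linarith)
  rcases le_or_gt M 0 with hM0 | hM0
  · have : 0 ≤ u x₀ / δ := by positivity
    linarith
  obtain ⟨hC1, hFd, hLap⟩ := hu_super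
  have hopen : IsOpen {x : EuclideanSpace ℝ (Fin N) | 1 < ‖x‖} :=
    isOpen_lt continuous_const continuous_norm
  set k : ℝ := M * (3 / 2 : ℝ) ^ α with hk
  have hk0 : 0 < k := by positivity
  set K : Set (EuclideanSpace ℝ (Fin N)) := {x | 3 / 2 ≤ ‖x‖ ∧ ‖x‖ ≤ 3 / 2 * r}
  have hKc : IsCompact K := by
    refine (isCompact_closedBall (0 : EuclideanSpace ℝ (Fin N)) (3 / 2 * r)).of_isClosed_subset
      ?_ fun x hx => by simpa using hx.2
    exact (isClosed_le continuous_const continuous_norm).inter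
      (isClosed_le continuous_norm continuous_const)
  have hx₀K : x₀ ∈ K := ⟨by rw [hx₀]; norm_num, by rw [hx₀]; linarith⟩
  have hcont : ContinuousOn (fun y => u y + k * ‖y‖ ^ (-α)) K := by
    refine (hC1.continuousOn.mono fun x hx => ?_).add (continuousOn_const.mul
      (continuous_norm.continuousOn.rpow_const fun x hx => Or.inl ?_))
    · have := hx.1
      simp only [Set.mem_ofPred_eq]
      linarith
    · have := hx.1
      positivity
  obtain ⟨x, hxK, hxmin⟩ := hKc.exists_isMinOn ⟨x₀, hx₀K⟩ hcont
  have hx1 : 1 < ‖x‖ := by linarith [hxK.1]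
  have hge : M ≤ u x + k * ‖x‖ ^ (-α) := by
    rcases hxK.1.eq_or_lt with h | h
    · rw [← h, hk, mul_assoc, ← Real.rpow_add (by norm_num), add_neg_cancel, Real.rpow_zero]
      linarith [hu_nonneg x hx1]
    rcases hxK.2.eq_or_lt with h' | h'
    · have : 0 ≤ k * ‖x‖ ^ (-α) := by positivity
      linarith [hM x (by linarith) (by linarith)]
    · exfalso
      have hnhds := hopen.mem_nhds (x := x) hx1
      refine not_isLocalMin_sub_barrier hp (norm_pos_iff.1 (by linarith)) ?_
        (hFd.differentiableAt hnhds) (by simpa using hLap x hx1) hk0 hα0 hαp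
        (hxmin.isLocalMin ?_)
      · filter_upwards [hnhds] with y hy
        exact (hC1.differentiableOn one_ne_zero).differentiableAt (hopen.mem_nhds hy)
      · filter_upwards [(isOpen_lt continuous_const continuous_norm).mem_nhds h,
          (isOpen_lt continuous_norm continuous_const).mem_nhds h'] with y h1 h2
        exact ⟨le_of_lt h1, le_of_lt h2⟩
  have hfin : M ≤ u x₀ + k * ‖x₀‖ ^ (-α) := hge.trans (hxmin hx₀K)
  rw [hx₀] at hfin
  have : M ≤ u x₀ / δ := by
    rw [le_div_iff₀ hδ0, hδ]
    rw [hk] at hfin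
    linarith
  linarith
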